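/- arXiv:2604.01157 — 4 statements merged into one kernel-verified Lean document; each statement's English description precedes it below -/
import Mathlib

section
/- Fix T > 0. The function f : (0, ∞) → ℝ defined by f(x) = x · coth(x/(2T)) is strictly increasing: for all 0 < x < y one has x · coth(x/(2T)) < y · coth(y/(2T)). -/
/-- The hyperbolic cotangent `coth u = cosh u / sinh u`. -/
noncomputable def coth (u : ℝ) : ℝ := Real.cosh u / Real.sinh u

theorem hasDerivAt_mul_coth {u : ℝ} (hu : u ≠ 0) :
    HasDerivAt (fun u => u * coth u)
      ((Real.sinh u * Real.cosh u - u) / Real.sinh u ^ 2) u := by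
  have hs : Real.sinh u ≠ 0 := Real.sinh_ne_zero.2 hu
  refine ((hasDerivAt_id' u).mul
    ((Real.hasDerivAt_cosh u).div (Real.hasDerivAt_sinh u) hs)).congr_deriv ?_
  simp only [Pi.div_apply]
  field_simp
  linear_combination -u * Real.cosh_sq_sub_sinh_sq u

theorem strictMonoOn_mul_coth : StrictMonoOn (fun u => u * coth u) (Set.Ioi 0) := by
  refine strictMonoOn_of_deriv_pos (convex_Ioi 0)
    (fun u hu => (hasDerivAt_mul_coth (ne_of_gt hu)).continuousAt.continuousWithinAt) ?_
  intro u hu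
  rw [interior_Ioi, Set.mem_Ioi] at hu
  rw [(hasDerivAt_mul_coth hu.ne').deriv]
  have hs : 0 < Real.sinh u := Real.sinh_pos_iff.2 hu
  have hlt : u < Real.sinh u := Real.self_lt_sinh_iff.2 hu
  have hle : Real.sinh u ≤ Real.sinh u * Real.cosh u :=
    le_mul_of_one_le_right hs.le (Real.one_le_cosh u)
  exact div_pos (by linarith) (by positivity)

/-- For fixed `T > 0`, the function `x ↦ x · coth(x/(2T))` is strictly increasing
on `(0, ∞)`. -/
theorem mul_coth_strictMono (T : ℝ) (hT : 0 < T) :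
    ∀ x y : ℝ, 0 < x → x < y →
      x * coth (x / (2 * T)) < y * coth (y / (2 * T)) := by
  intro x y hx hxy
  have hT2 : 0 < 2 * T := by positivity
  have h := strictMonoOn_mul_coth (div_pos hx hT2) (div_pos (hx.trans hxy) hT2)
    (div_lt_div_of_pos_right hxy hT2)
  simp only [div_mul_eq_mul_div] at h
  exact (div_lt_div_iff_of_pos_right hT2).1 h
end

section
/- Let N ≥ 1, Δ > 0, let O be an orthogonal N×N real matrix (Oᵀ O = 𝟙_N), and let α, β : {1, …, N} → ℝ be strictly positive sequences with α monotonically nondecreasing in k and β monotonically nonincreasing in k. Let S be the 2N×2N block-diagonal matrix S = O ⊕ O, let D = diag(α₁, …, α_N) ⊕ diag(β₁, …, β_N), and set Γ = S D Sᵀ. Then there exists a real number a > 0 such that the 2N×2N matrix Γ − (1/Δ)·[ (1/(2a))·𝟙_N ⊕ (a/2)·𝟙_N ] is positive semidefinite if and only if α₁ · β_N ≥ 1/(4Δ²). -/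
open Matrix

/-- Subtracting scalar blocks `u • 1 ⊕ v • 1` from an orthogonally conjugated `diag α ⊕ diag β`
leaves a positive semidefinite matrix iff `u` bounds `α` below and `v` bounds `β` below. -/
theorem posSemidef_conj_fromBlocks_sub_smul_iff {n : Type*} [Fintype n] [DecidableEq n]
    {O : Matrix n n ℝ} (hO : Oᵀ * O = 1) (α β : n → ℝ) (u v : ℝ) :
    (fromBlocks O 0 0 O * fromBlocks (diagonal α) 0 0 (diagonal β) * (fromBlocks O 0 0 O)ᵀ -
        fromBlocks (u • (1 : Matrix n n ℝ)) 0 0 (v • (1 : Matrix n n ℝ))).PosSemidef ↔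
      (∀ k, u ≤ α k) ∧ ∀ k, v ≤ β k := by
  have hO' : O * Oᵀ = 1 := mul_eq_one_comm.mp hO
  have hU : IsUnit (fromBlocks O 0 0 O) :=
    IsUnit.of_mul_eq_one (fromBlocks O 0 0 O)ᵀ (by simp [fromBlocks_transpose,
      fromBlocks_multiply, hO'])
  have hconj : fromBlocks O 0 0 O * fromBlocks (diagonal α) 0 0 (diagonal β) *
        (fromBlocks O 0 0 O)ᵀ -
        fromBlocks (u • (1 : Matrix n n ℝ)) 0 0 (v • (1 : Matrix n n ℝ)) =
      fromBlocks O 0 0 O *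
        diagonal (Sum.elim (fun k => α k - u) fun k => β k - v) * star (fromBlocks O 0 0 O) := by
    have hdiag (d : n → ℝ) (c : ℝ) :
        (diagonal fun k => d k - c) = diagonal d - c • (1 : Matrix n n ℝ) := by
      rw [smul_one_eq_diagonal, diagonal_sub]
    rw [← fromBlocks_diagonal, hdiag, hdiag, star_eq_conjTranspose,
      conjTranspose_eq_transpose_of_trivial, sub_eq_iff_eq_add]
    simp [-fromBlocks_diagonal, fromBlocks_transpose, fromBlocks_multiply, fromBlocks_add,
      mul_sub, sub_mul, hO']
  rw [hconj, hU.posSemidef_star_right_conjugate_iff, posSemidef_diagonal_iff]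
  simp

/-- Covariance-matrix-criterion benchmark for the thermal covariance matrix:
with `Γ = (O ⊕ O) (diag α ⊕ diag β) (O ⊕ O)ᵀ`, where `O` is orthogonal,
`α` is positive nondecreasing and `β` positive nonincreasing, there exists
`a > 0` with `Γ − (1/Δ)·[(1/(2a))𝟙 ⊕ (a/2)𝟙] ⪰ 0` iff `α₁ · β_N ≥ 1/(4Δ²)`. -/
theorem cmc_benchmark_iff (N : ℕ) (hN : 1 ≤ N) (Δ : ℝ) (hΔ : 0 < Δ)
    (O : Matrix (Fin N) (Fin N) ℝ) (hO : Oᵀ * O = 1)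
    (α β : Fin N → ℝ)
    (hαpos : ∀ k, 0 < α k) (hβpos : ∀ k, 0 < β k)
    (hαmono : ∀ i j : Fin N, i ≤ j → α i ≤ α j)
    (hβanti : ∀ i j : Fin N, i ≤ j → β j ≤ β i) :
    (∃ a : ℝ, 0 < a ∧
        (fromBlocks O 0 0 O * fromBlocks (diagonal α) 0 0 (diagonal β) *
            (fromBlocks O 0 0 O)ᵀ -
          (1 / Δ) • fromBlocks ((1 / (2 * a)) • (1 : Matrix (Fin N) (Fin N) ℝ)) 0 0
            ((a / 2) • (1 : Matrix (Fin N) (Fin N) ℝ))).PosSemidef) ↔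
      α ⟨0, by omega⟩ * β ⟨N - 1, by omega⟩ ≥ 1 / (4 * Δ ^ 2) := by
  simp only [fromBlocks_smul, smul_zero, smul_smul, posSemidef_conj_fromBlocks_sub_smul_iff hO]
  constructor
  · rintro ⟨a, ha, hα, hβ⟩
    calc 1 / (4 * Δ ^ 2) = 1 / Δ * (1 / (2 * a)) * (1 / Δ * (a / 2)) := by field_simp; norm_num
      _ ≤ α ⟨0, by omega⟩ * β ⟨N - 1, by omega⟩ :=
        mul_le_mul (hα _) (hβ _) (by positivity) (hαpos _).le
  · intro h
    have hα₀ := hαpos ⟨0, by omega⟩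
    refine ⟨1 / (2 * Δ * α ⟨0, by omega⟩), by positivity, fun k => ?_, fun k => ?_⟩
    · calc 1 / Δ * (1 / (2 * (1 / (2 * Δ * α ⟨0, by omega⟩)))) = α ⟨0, by omega⟩ := by field_simp
        _ ≤ α k := hαmono _ _ (Fin.mk_le_of_le_val (Nat.zero_le _))
    · calc 1 / Δ * (1 / (2 * Δ * α ⟨0, by omega⟩) / 2)
          = 1 / (4 * Δ ^ 2) / α ⟨0, by omega⟩ := by field_simp; norm_num
        _ ≤ β ⟨N - 1, by omega⟩ := (div_le_iff₀' hα₀).mpr h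
        _ ≤ β k := hβanti _ _ (Fin.mk_le_mk.mpr (by omega))
end

section
/- Let ω₁ and ω_N be real numbers with 0 < ω₁ < ω_N, and define f : (0, ∞) → ℝ by f(T) = √( (ω₁/ω_N) · coth(ω₁/(2T)) · coth(ω_N/(2T)) ). Then there exists a unique T* > 0 with f(T*) = 1; moreover f(T) < 1 for all 0 < T < T* and f(T) > 1 for all T > T*. Consequently, the witness value W(T) = 1 − f(T) is strictly positive for T < T* and strictly negative for T > T*, so entanglement is detected exactly below the critical temperature T*. -/
theorem tanh_strictMono : StrictMono Real.tanh := by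
  intro x y hxy
  rw [Real.tanh_eq_sinh_div_cosh, Real.tanh_eq_sinh_div_cosh,
    div_lt_div_iff₀ (Real.cosh_pos x) (Real.cosh_pos y)]
  have hsinh : 0 < Real.sinh (y - x) := Real.sinh_pos_iff.2 (sub_pos.2 hxy)
  rw [Real.sinh_sub] at hsinh
  linarith

theorem tanh_pos {x : ℝ} (hx : 0 < x) : 0 < Real.tanh x := by
  simpa using tanh_strictMono hx

theorem continuous_tanh : Continuous Real.tanh := by
  have heq : Real.tanh = fun x => Real.sinh x / Real.cosh x :=
    funext Real.tanh_eq_sinh_div_cosh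
  rw [heq]
  exact Real.continuous_sinh.div Real.continuous_cosh fun x => (Real.cosh_pos x).ne'

theorem coth_eq_inv_tanh (u : ℝ) : coth u = (Real.tanh u)⁻¹ := by
  rw [coth, Real.tanh_eq_sinh_div_cosh, inv_div]

theorem tanh_mul_tanh_strictMonoOn {a b : ℝ} (ha : 0 < a) (hb : 0 < b) :
    StrictMonoOn (fun s => Real.tanh (a * s) * Real.tanh (b * s)) (Set.Ioi 0) := by
  intro s hs t ht hst
  have hs : 0 < s := hs
  exact mul_lt_mul'' (tanh_strictMono (by gcongr)) (tanh_strictMono (by gcongr))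
    (tanh_pos (by positivity)).le (tanh_pos (by positivity)).le

theorem exists_tanh_mul_tanh_eq {a b r : ℝ} (ha : 0 < a) (hab : a ≤ b) (hr₀ : 0 < r)
    (hr₁ : r < 1) : ∃ s, 0 < s ∧ Real.tanh (a * s) * Real.tanh (b * s) = r := by
  have hc₀ : 0 < √r := Real.sqrt_pos.2 hr₀
  have hc₁ : √r < 1 := by rw [Real.sqrt_lt' one_pos]; simpa using hr₁
  have hpos : 0 < Real.artanh (√r) := Real.artanh_pos ⟨hc₀, hc₁⟩
  set M := Real.artanh (√r) / a with hM
  have hM₀ : 0 < M := by positivity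
  have haM : Real.tanh (a * M) = √r := by
    rw [hM, mul_div_cancel₀ _ ha.ne', Real.tanh_artanh ⟨by linarith, hc₁⟩]
  have hbM : √r ≤ Real.tanh (b * M) := by
    rw [← haM]
    exact tanh_strictMono.monotone (by gcongr)
  have hcont : Continuous fun s => Real.tanh (a * s) * Real.tanh (b * s) :=
    (continuous_tanh.comp (continuous_const.mul continuous_id)).mul
      (continuous_tanh.comp (continuous_const.mul continuous_id))
  obtain ⟨s, hs, hsr⟩ := intermediate_value_Icc hM₀.le hcont.continuousOn
    (show r ∈ Set.Icc _ _ from ⟨by simpa using hr₀.le, by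
      have := mul_le_mul_of_nonneg_left hbM hc₀.le
      rw [Real.mul_self_sqrt hr₀.le] at this
      simpa only [haM] using this⟩)
  refine ⟨s, lt_of_le_of_ne hs.1 ?_, hsr⟩
  rintro rfl
  simp at hsr
  exact hr₀.ne hsr

/-- The thermal function under the square root, in terms of the rescaled inverse temperature
`s = 1 / (2 * T)`. -/
theorem mul_coth_mul_coth_eq_div (a b T : ℝ) :
    a / b * coth (a / (2 * T)) * coth (b / (2 * T)) =
      a / b / (Real.tanh (a * (1 / (2 * T))) * Real.tanh (b * (1 / (2 * T)))) := by
  rw [coth_eq_inv_tanh, coth_eq_inv_tanh, mul_one_div, mul_one_div, div_eq_mul_inv (a / b),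
    mul_inv, mul_assoc]

/-- For `0 < ω₁ < ω_N`, the function
`f(T) = √((ω₁/ω_N) coth(ω₁/(2T)) coth(ω_N/(2T)))` crosses the value `1` at a
unique critical temperature `T* > 0`, with `f < 1` below `T*` and `f > 1`
above `T*`; consequently the witness `W(T) = 1 − f(T)` is strictly positive
for `T < T*` and strictly negative for `T > T*`. -/
theorem critical_temperature (ω₁ ωN : ℝ) (hω₁ : 0 < ω₁) (h : ω₁ < ωN) :
    ∃ Tstar : ℝ, 0 < Tstar ∧
      Real.sqrt ((ω₁ / ωN) * coth (ω₁ / (2 * Tstar)) * coth (ωN / (2 * Tstar))) = 1 ∧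
      (∀ T' : ℝ, 0 < T' →
        Real.sqrt ((ω₁ / ωN) * coth (ω₁ / (2 * T')) * coth (ωN / (2 * T'))) = 1 →
          T' = Tstar) ∧
      (∀ T : ℝ, 0 < T → T < Tstar →
        Real.sqrt ((ω₁ / ωN) * coth (ω₁ / (2 * T)) * coth (ωN / (2 * T))) < 1) ∧
      (∀ T : ℝ, Tstar < T →
        Real.sqrt ((ω₁ / ωN) * coth (ω₁ / (2 * T)) * coth (ωN / (2 * T))) > 1) ∧
      (∀ T : ℝ, 0 < T → T < Tstar →
        0 < 1 - Real.sqrt ((ω₁ / ωN) * coth (ω₁ / (2 * T)) * coth (ωN / (2 * T)))) ∧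
      (∀ T : ℝ, Tstar < T →
        1 - Real.sqrt ((ω₁ / ωN) * coth (ω₁ / (2 * T)) * coth (ωN / (2 * T))) < 0) := by
  have hωN : 0 < ωN := hω₁.trans h
  obtain ⟨s, hs, hsr⟩ := exists_tanh_mul_tanh_eq hω₁ h.le (div_pos hω₁ hωN)
    ((div_lt_one hωN).2 h)
  have hmono := tanh_mul_tanh_strictMonoOn hω₁ hωN
  have hinv : 1 / (2 * (1 / (2 * s))) = s := by field_simp
  have hr : 0 < ω₁ / ωN := div_pos hω₁ hωN
  have hstar : 0 < 1 / (2 * s) := by positivity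
  have hbelow : ∀ T : ℝ, 0 < T → T < 1 / (2 * s) →
      Real.sqrt ((ω₁ / ωN) * coth (ω₁ / (2 * T)) * coth (ωN / (2 * T))) < 1 := by
    intro T hT hlt
    have hsT : s < 1 / (2 * T) := by
      rw [← hinv]
      exact one_div_lt_one_div_of_lt (by positivity) (by linarith)
    have hP := hmono hs (hs.trans hsT) hsT
    simp only [hsr] at hP
    rw [mul_coth_mul_coth_eq_div, Real.sqrt_lt' one_pos, one_pow, div_lt_one (hr.trans hP)]
    exact hP
  have habove : ∀ T : ℝ, 1 / (2 * s) < T →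
      Real.sqrt ((ω₁ / ωN) * coth (ω₁ / (2 * T)) * coth (ωN / (2 * T))) > 1 := by
    intro T hlt
    have hT : 0 < T := hstar.trans hlt
    have hT' : 0 < 1 / (2 * T) := by positivity
    have hsT : 1 / (2 * T) < s := by
      rw [← hinv]
      exact one_div_lt_one_div_of_lt (by positivity) (by linarith)
    have hP := hmono hT' hs hsT
    simp only [hsr] at hP
    have hP₀ : 0 < Real.tanh (ω₁ * (1 / (2 * T))) * Real.tanh (ωN * (1 / (2 * T))) :=
      mul_pos (tanh_pos (by positivity)) (tanh_pos (by positivity))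
    rw [mul_coth_mul_coth_eq_div, gt_iff_lt, Real.lt_sqrt zero_le_one, one_pow, one_lt_div hP₀]
    exact hP
  refine ⟨1 / (2 * s), hstar, ?_, ?_, hbelow, habove,
    fun T hT hlt => sub_pos.2 (hbelow T hT hlt), fun T hlt => sub_neg.2 (habove T hlt)⟩
  · rw [mul_coth_mul_coth_eq_div, hinv, hsr, div_self hr.ne', Real.sqrt_one]
  · intro T hT heq
    rcases lt_trichotomy T (1 / (2 * s)) with hlt | rfl | hgt
    · exact absurd heq (hbelow T hT hlt).ne
    · rfl
    · exact absurd heq (habove T hgt).ne'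
end

section
/- Fix c > 0 and define θ_N = π/(2(N+1)) for each natural number N ≥ 1. Then the limit as N → ∞ of 1 − √( tan(θ_N) · coth(c N · sin(θ_N)) · coth(c N · cos(θ_N)) ) equals 1. -/
open Real Filter

theorem continuousAt_coth {u : ℝ} (hu : u ≠ 0) : ContinuousAt coth u :=
  Real.continuous_cosh.continuousAt.div Real.continuous_sinh.continuousAt
    (Real.sinh_ne_zero.mpr hu)

theorem coth_eq_exp (u : ℝ) :
    coth u = (1 + Real.exp (-u) * Real.exp (-u)) / (1 - Real.exp (-u) * Real.exp (-u)) := by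
  have h : Real.exp u * Real.exp (-u) = 1 := by rw [← Real.exp_add]; simp
  rw [coth, Real.cosh_eq, Real.sinh_eq, div_div_div_cancel_right₀ two_ne_zero,
    ← mul_div_mul_right _ _ (Real.exp_ne_zero (-u)), add_mul, sub_mul, h]

theorem tendsto_coth_atTop : Tendsto coth atTop (nhds 1) := by
  have h := Real.tendsto_exp_neg_atTop_nhds_zero.mul Real.tendsto_exp_neg_atTop_nhds_zero
  have h' := (h.const_add 1).div (h.const_sub 1) (by norm_num)
  simp only [mul_zero, add_zero, sub_zero, div_one] at h'
  exact h'.congr fun u => (coth_eq_exp u).symm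

theorem tendsto_pi_div_two_mul_add_one :
    Tendsto (fun N : ℕ => π / (2 * ((N : ℝ) + 1))) atTop (nhds 0) := by
  have h := (tendsto_one_div_add_atTop_nhds_zero_nat (𝕜 := ℝ)).const_mul (π / 2)
  rw [mul_zero] at h
  exact h.congr fun N => by rw [div_mul_div_comm, mul_one]

theorem tendsto_mul_sin_pi_div_two_mul_add_one :
    Tendsto (fun N : ℕ => (N : ℝ) * Real.sin (π / (2 * ((N : ℝ) + 1)))) atTop
      (nhds (π / 2)) := by
  have hsinc := (Real.continuous_sinc.tendsto 0).comp tendsto_pi_div_two_mul_add_one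
  have h := ((tendsto_natCast_div_add_atTop (1 : ℝ)).const_mul (π / 2)).mul hsinc
  simp only [Real.sinc_zero, mul_one] at h
  refine h.congr fun N => ?_
  rw [Function.comp_apply, Real.sinc_of_ne_zero (by positivity)]
  field_simp

/-- Continuum limit at fixed physical length: with `θ_N = π/(2(N+1))` and fixed
`c > 0`, the witness value
`1 − √(tan θ_N · coth(cN sin θ_N) · coth(cN cos θ_N))` tends to `1` as `N → ∞`. -/
theorem witness_limit_continuum (c : ℝ) (hc : 0 < c) :
    Filter.Tendsto
      (fun N : ℕ =>
        1 - Real.sqrt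
          (Real.tan (π / (2 * (N + 1))) *
            coth (c * N * Real.sin (π / (2 * (N + 1)))) *
            coth (c * N * Real.cos (π / (2 * (N + 1))))))
      Filter.atTop (nhds 1) := by
  have htan : Tendsto (fun N : ℕ => Real.tan (π / (2 * ((N : ℝ) + 1)))) atTop (nhds 0) := by
    have h := (Real.continuousAt_tan.mpr (by simp : Real.cos 0 ≠ 0)).tendsto.comp
      tendsto_pi_div_two_mul_add_one
    rwa [Real.tan_zero] at h
  have hsin : Tendsto (fun N : ℕ => coth (c * N * Real.sin (π / (2 * ((N : ℝ) + 1)))))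
      atTop (nhds (coth (c * (π / 2)))) := by
    have h := (continuousAt_coth (by positivity : c * (π / 2) ≠ 0)).tendsto.comp
      (tendsto_mul_sin_pi_div_two_mul_add_one.const_mul c)
    exact h.congr fun N => by rw [Function.comp_apply, mul_assoc]
  have hcos : Tendsto (fun N : ℕ => coth (c * N * Real.cos (π / (2 * ((N : ℝ) + 1)))))
      atTop (nhds 1) := by
    have h := (Real.continuous_cos.tendsto 0).comp tendsto_pi_div_two_mul_add_one
    rw [Real.cos_zero] at h
    exact tendsto_coth_atTop.comp
      ((tendsto_natCast_atTop_atTop.const_mul_atTop hc).atTop_mul_pos one_pos h)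
  have h := ((htan.mul hsin).mul hcos).sqrt.const_sub 1
  simpa only [zero_mul, Real.sqrt_zero, sub_zero] using h
end
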